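/- Let s₀ < 0 be a real number, δ > 0, and let f, g : [0,∞) → ℝ be continuous with |f(ξ)| ≤ C e^{−δξ} and |g(ξ)| ≤ C e^{−δξ} for all ξ ≥ 0 and some constant C. For z on the unit circle with z ≠ 1, define (𝓜𝓛f)(z) = (Lf)(s₀(z+1)/(z−1))/(z−1), where (Lh)(s) = ∫₀^∞ e^{−sξ} h(ξ) dξ (this is well defined since s₀(z+1)/(z−1) is purely imaginary for |z| = 1, z ≠ 1). Then ∫₀^∞ f(ξ)·g(ξ) dξ = −(s₀/π)·∫₀^{2π} (𝓜𝓛f)(e^{−iθ})·(𝓜𝓛g)(e^{iθ}) dθ. -/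

import Mathlib

open Complex MeasureTheory Set Real

open FourierTransform SchwartzMap in
/-- The `L²` Fourier transform of an integrable square-integrable function is given by the
Fourier integral. -/
theorem MeasureTheory.MemLp.coeFn_fourier_toLp_ae_eq {u : ℝ → ℂ} (h₁ : Integrable u)
    (h₂ : MemLp u 2) : (𝓕 (h₂.toLp u) : Lp ℂ 2) =ᵐ[volume] 𝓕 u := by
  have hcont : Continuous (𝓕 u) :=
    VectorFourier.fourierIntegral_continuous Real.continuous_fourierChar
      (L := innerₗ ℝ) continuous_inner h₁
  refine ae_eq_of_integral_contDiff_smul_eq ((Lp.memLp _).locallyIntegrable (by norm_num))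
    hcont.locallyIntegrable fun φ hφ hsupp ↦ ?_
  have hsupp' : HasCompactSupport (fun x ↦ (φ x : ℂ)) := hsupp.comp_left Complex.ofReal_zero
  set ψ : 𝓢(ℝ, ℂ) := hsupp'.toSchwartzMap (Complex.ofRealCLM.contDiff.comp hφ)
  have hψ (x : ℝ) : ψ x = (φ x : ℂ) := rfl
  have hdist := congrArg (fun T : 𝓢'(ℝ, ℂ) ↦ T ψ)
    (Lp.fourier_toTemperedDistribution_eq (h₂.toLp u))
  simp only [TemperedDistribution.fourier_apply, Lp.toTemperedDistribution_apply] at hdist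
  have hswap := VectorFourier.integral_fourierIntegral_smul_eq_flip (L := innerₗ ℝ)
    Real.continuous_fourierChar continuous_inner ψ.integrable h₁ (μ := volume) (ν := volume)
  rw [flip_innerₗ] at hswap
  calc ∫ x, φ x • (𝓕 (h₂.toLp u) : Lp ℂ 2 volume) x
      = ∫ x, ψ x • (𝓕 (h₂.toLp u) : Lp ℂ 2 volume) x := by simp [hψ]
    _ = ∫ x, (𝓕 ψ) x • (h₂.toLp u) x := hdist.symm
    _ = ∫ x, (𝓕 ψ) x • u x := by
        refine integral_congr_ae ?_
        filter_upwards [h₂.coeFn_toLp] with x hx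
        rw [hx]
    _ = ∫ x, ψ x • 𝓕 u x := hswap
    _ = ∫ x, φ x • 𝓕 u x := by simp [hψ]

open FourierTransform in
/-- **Plancherel's theorem** for integrable square-integrable functions on `ℝ`. -/
theorem integral_inner_fourier_eq {u v : ℝ → ℂ} (hu₁ : Integrable u) (hu₂ : MemLp u 2)
    (hv₁ : Integrable v) (hv₂ : MemLp v 2) :
    ∫ x, inner ℂ (𝓕 u x) (𝓕 v x) = ∫ x, inner ℂ (u x) (v x) := by
  have h := Lp.inner_fourier_eq (hu₂.toLp u) (hv₂.toLp v)
  rw [L2.inner_def, L2.inner_def] at h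
  refine (integral_congr_ae ?_).trans (h.trans (integral_congr_ae ?_))
  · filter_upwards [hu₂.coeFn_fourier_toLp_ae_eq hu₁, hv₂.coeFn_fourier_toLp_ae_eq hv₁]
      with x hx hy
    rw [hx, hy]
  · filter_upwards [hu₂.coeFn_toLp, hv₂.coeFn_toLp] with x hx hy
    rw [hx, hy]

/-- Extension by zero of an exponentially bounded continuous function on the half-line is
integrable and square-integrable. -/
theorem integrable_memLp_two_indicator_of_abs_le_exp {δ C : ℝ} (hδ : 0 < δ) {f : ℝ → ℝ}
    (hf : ContinuousOn f (Ici 0)) (hbf : ∀ ξ : ℝ, 0 ≤ ξ → |f ξ| ≤ C * Real.exp (-δ * ξ)) :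
    Integrable ((Ioi (0 : ℝ)).indicator fun ξ ↦ (f ξ : ℂ)) ∧
      MemLp ((Ioi (0 : ℝ)).indicator fun ξ ↦ (f ξ : ℂ)) 2 := by
  have hmeas : AEStronglyMeasurable (fun ξ ↦ (f ξ : ℂ)) (volume.restrict (Ioi 0)) :=
    (Complex.continuous_ofReal.comp_continuousOn
      (hf.mono Ioi_subset_Ici_self)).aestronglyMeasurable measurableSet_Ioi
  rw [integrable_indicator_iff measurableSet_Ioi, memLp_indicator_iff_restrict measurableSet_Ioi,
    memLp_two_iff_integrable_sq_norm hmeas]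
  refine ⟨((exp_neg_integrableOn_Ioi 0 hδ).const_mul C).mono' hmeas ?_,
    ((exp_neg_integrableOn_Ioi 0 (mul_pos two_pos hδ)).const_mul (C ^ 2)).mono'
      (hmeas.norm.pow 2) ?_⟩
  · filter_upwards [ae_restrict_mem measurableSet_Ioi] with ξ hξ
    simpa using hbf ξ (le_of_lt hξ)
  · filter_upwards [ae_restrict_mem measurableSet_Ioi] with ξ hξ
    have h := pow_le_pow_left₀ (abs_nonneg _) (hbf ξ (le_of_lt hξ)) 2
    rw [mul_pow, ← Real.exp_nat_mul, sq_abs] at h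
    have hexp : ((2 : ℕ) : ℝ) * (-δ * ξ) = -(2 * δ) * ξ := by
      push_cast
      ring
    rw [hexp] at h
    simpa using h

open FourierTransform in
theorem fourier_indicator_Ioi_eq_laplace (f : ℝ → ℝ) (x : ℝ) :
    𝓕 ((Ioi (0 : ℝ)).indicator fun ξ ↦ (f ξ : ℂ)) x =
      ∫ ξ in Ioi (0 : ℝ), Complex.exp (-(2 * π * x * I) * ξ) * (f ξ : ℂ) := by
  rw [Real.fourier_real_eq_integral_exp_smul, ← integral_indicator measurableSet_Ioi]
  refine integral_congr_ae (.of_forall fun ξ ↦ ?_)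
  by_cases hξ : ξ ∈ Ioi (0 : ℝ)
  · simp only [indicator_of_mem hξ, smul_eq_mul]
    congr 2
    push_cast
    ring
  · simp [indicator_of_notMem hξ]

theorem conj_laplace_eq (f : ℝ → ℝ) (s : ℂ) :
    (starRingEnd ℂ) (∫ ξ in Ioi (0 : ℝ), Complex.exp (-s * ξ) * (f ξ : ℂ)) =
      ∫ ξ in Ioi (0 : ℝ), Complex.exp (-(starRingEnd ℂ s) * ξ) * (f ξ : ℂ) := by
  rw [← integral_conj]
  simp [← Complex.exp_conj]

/-- **Plancherel's theorem** for Laplace transforms on the imaginary axis. -/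
theorem integral_laplace_mul_laplace {δ C : ℝ} (hδ : 0 < δ) {f g : ℝ → ℝ}
    (hf : ContinuousOn f (Ici 0)) (hg : ContinuousOn g (Ici 0))
    (hbf : ∀ ξ : ℝ, 0 ≤ ξ → |f ξ| ≤ C * Real.exp (-δ * ξ))
    (hbg : ∀ ξ : ℝ, 0 ≤ ξ → |g ξ| ≤ C * Real.exp (-δ * ξ)) :
    ∫ x : ℝ, (∫ ξ in Ioi (0 : ℝ), Complex.exp (-(-(2 * π * x * I)) * ξ) * (f ξ : ℂ)) *
        ∫ ξ in Ioi (0 : ℝ), Complex.exp (-(2 * π * x * I) * ξ) * (g ξ : ℂ) =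
      ((∫ ξ in Ioi (0 : ℝ), f ξ * g ξ : ℝ) : ℂ) := by
  obtain ⟨hf₁, hf₂⟩ := integrable_memLp_two_indicator_of_abs_le_exp hδ hf hbf
  obtain ⟨hg₁, hg₂⟩ := integrable_memLp_two_indicator_of_abs_le_exp hδ hg hbg
  have h := integral_inner_fourier_eq hf₁ hf₂ hg₁ hg₂
  simp only [RCLike.inner_apply', fourier_indicator_Ioi_eq_laplace, conj_laplace_eq] at h
  rw [← integral_complex_ofReal, ← integral_indicator measurableSet_Ioi]
  convert h using 1
  · simp only [map_mul, Complex.conj_I, Complex.conj_ofReal, map_ofNat, mul_neg]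
  · refine integral_congr_ae (.of_forall fun ξ ↦ ?_)
    by_cases hξ : ξ ∈ Ioi (0 : ℝ)
    · simp [indicator_of_mem hξ]
    · simp [indicator_of_notMem hξ]

theorem cexp_I_mul_pi_sub_two_arctan (t : ℝ) :
    Complex.exp (I * ((π - 2 * Real.arctan t : ℝ) : ℂ)) = (I * t - 1) / (I * t + 1) := by
  have hcos : (Real.cos (Real.arctan t) : ℂ) ≠ 0 := by
    exact_mod_cast (Real.cos_arctan_pos t).ne'
  have ht : (Real.sin (Real.arctan t) : ℂ) = t * Real.cos (Real.arctan t) := by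
    rw [← Complex.ofReal_mul, ← Real.tan_mul_cos (Real.cos_arctan_pos t).ne', Real.tan_arctan]
  have hp : I * (t : ℂ) + 1 ≠ 0 := fun h ↦ by simpa using congrArg Complex.re h
  have hE : Complex.exp (Real.arctan t * I) = Real.cos (Real.arctan t) * (I * t + 1) := by
    rw [Complex.exp_mul_I, ← Complex.ofReal_cos, ← Complex.ofReal_sin, ht]
    ring
  have hE' : Complex.exp (-(Real.arctan t) * I) = Real.cos (Real.arctan t) * (1 - I * t) := by
    rw [Complex.exp_mul_I, Complex.cos_neg, Complex.sin_neg, ← Complex.ofReal_cos,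
      ← Complex.ofReal_sin, ht]
    ring
  have hsplit : Complex.exp (I * ((π - 2 * Real.arctan t : ℝ) : ℂ)) *
      Complex.exp (Real.arctan t * I) = -Complex.exp (-(Real.arctan t) * I) := by
    rw [← Complex.exp_add, ← neg_one_mul, ← Complex.exp_pi_mul_I, ← Complex.exp_add]
    congr 1
    push_cast
    ring
  rw [hE, hE'] at hsplit
  rw [eq_div_iff hp]
  apply mul_left_cancel₀ hcos
  linear_combination hsplit

theorem image_pi_sub_two_arctan {a : ℝ} (ha : a ≠ 0) :
    (fun x ↦ π - 2 * Real.arctan (a * x)) '' univ = Ioo 0 (2 * π) := by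
  ext θ
  simp only [image_univ, mem_range, mem_Ioo]
  constructor
  · rintro ⟨x, rfl⟩
    constructor <;>
      linarith [Real.arctan_lt_pi_div_two (a * x), Real.neg_pi_div_two_lt_arctan (a * x)]
  · rintro ⟨h₀, h₁⟩
    refine ⟨Real.tan ((π - θ) / 2) / a, ?_⟩
    rw [mul_div_cancel₀ _ ha, Real.arctan_tan (by linarith) (by linarith)]
    ring

/-- Substitution `θ = π - 2 arctan (a x)` in an integral over a period. -/
theorem intervalIntegral_eq_integral_arctan {a : ℝ} (ha : 0 < a) (F : ℝ → ℂ) :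
    ∫ θ in (0 : ℝ)..(2 * π), F θ =
      ∫ x : ℝ, (2 * a / (1 + (a * x) ^ 2)) • F (π - 2 * Real.arctan (a * x)) := by
  have hderiv (x : ℝ) : HasDerivWithinAt (fun x ↦ π - 2 * Real.arctan (a * x))
      (-(2 * a / (1 + (a * x) ^ 2))) univ x := by
    have h := ((((hasDerivAt_id x).const_mul a).arctan.const_mul 2).const_sub π).hasDerivWithinAt
      (s := univ)
    refine h.congr_deriv ?_
    simp only [id]
    ring
  have hinj : InjOn (fun x ↦ π - 2 * Real.arctan (a * x)) univ := by
    intro x _ y _ hxy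
    have h : Real.arctan (a * x) = Real.arctan (a * y) := by simpa using hxy
    exact mul_left_cancel₀ ha.ne' (Real.arctan_injective h)
  rw [intervalIntegral.integral_of_le (by positivity), integral_Ioc_eq_integral_Ioo,
    ← image_pi_sub_two_arctan ha.ne',
    integral_image_eq_integral_abs_deriv_smul .univ (fun x _ ↦ hderiv x) hinj, setIntegral_univ]
  refine integral_congr_ae (.of_forall fun x ↦ ?_)
  simp only [abs_neg]
  rw [abs_of_pos (by positivity)]

/-- Hardy-space identity converting the improper integral `∫₀^∞ f g dξ` over the radial
coordinate into a contour integral over the unit circle: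
`∫₀^∞ f g dξ = −(s₀/π) ∫₀^{2π} (𝓜𝓛f)(e^{−iθ}) (𝓜𝓛g)(e^{iθ}) dθ`. -/
theorem hardy_space_integral_identity
    (s₀ : ℝ) (hs₀ : s₀ < 0) (δ : ℝ) (hδ : 0 < δ) (f g : ℝ → ℝ) (C : ℝ)
    (hf : ContinuousOn f (Ici 0)) (hg : ContinuousOn g (Ici 0))
    (hbf : ∀ ξ : ℝ, 0 ≤ ξ → |f ξ| ≤ C * Real.exp (-δ * ξ))
    (hbg : ∀ ξ : ℝ, 0 ≤ ξ → |g ξ| ≤ C * Real.exp (-δ * ξ))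
    (Mf Mg : ℂ → ℂ)
    (hMf : ∀ z : ℂ, Mf z =
      (∫ ξ in Ioi (0 : ℝ),
        Complex.exp (-((s₀ : ℂ) * (z + 1) / (z - 1)) * ξ) * (f ξ : ℂ)) / (z - 1))
    (hMg : ∀ z : ℂ, Mg z =
      (∫ ξ in Ioi (0 : ℝ),
        Complex.exp (-((s₀ : ℂ) * (z + 1) / (z - 1)) * ξ) * (g ξ : ℂ)) / (z - 1)) :
    ((∫ ξ in Ioi (0 : ℝ), f ξ * g ξ : ℝ) : ℂ) =
      -((s₀ : ℂ) / (π : ℂ)) *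
        ∫ θ in (0 : ℝ)..(2 * π),
          Mf (Complex.exp (-(I * θ))) * Mg (Complex.exp (I * θ)) := by
  set a : ℝ := 2 * π / (-s₀) with ha_def
  have ha : 0 < a := div_pos (by positivity) (by linarith)
  rw [intervalIntegral_eq_integral_arctan ha, ← integral_laplace_mul_laplace hδ hf hg hbf hbg,
    ← integral_const_mul]
  refine integral_congr_ae (.of_forall fun x ↦ ?_)
  have hs : (s₀ : ℂ) ≠ 0 := by exact_mod_cast hs₀.ne
  have hπ : (π : ℂ) ≠ 0 := by exact_mod_cast Real.pi_ne_zero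
  obtain ⟨t, ht⟩ : ∃ t, t = a * x := ⟨_, rfl⟩
  have hst : (s₀ : ℂ) * t = -(2 * π * x) := by
    rw [ht, ha_def]
    push_cast
    field_simp
  have hsa : (s₀ : ℂ) * a = -(2 * π) := by
    rw [ha_def]
    push_cast
    field_simp
  have hp : I * (t : ℂ) + 1 ≠ 0 := fun h ↦ by simpa using congrArg Complex.re h
  have hm : I * (t : ℂ) - 1 ≠ 0 := fun h ↦ by simpa using congrArg Complex.re h
  have hexp := cexp_I_mul_pi_sub_two_arctan t
  have hexp' : Complex.exp (-(I * ((π - 2 * Real.arctan t : ℝ) : ℂ))) =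
      (I * t + 1) / (I * t - 1) := by
    rw [Complex.exp_neg, hexp, inv_div]
  have hz : (I * (t : ℂ) - 1) / (I * t + 1) - 1 = -2 / (I * t + 1) := by
    field_simp
    ring
  have hz' : (I * (t : ℂ) + 1) / (I * t - 1) - 1 = 2 / (I * t - 1) := by
    field_simp
    ring
  have hw : (s₀ : ℂ) * ((I * (t : ℂ) - 1) / (I * t + 1) + 1) / (-2 / (I * t + 1)) =
      2 * π * x * I := by
    field_simp
    linear_combination (-2 * I) * hst
  have hw' : (s₀ : ℂ) * ((I * (t : ℂ) + 1) / (I * t - 1) + 1) / (2 / (I * t - 1)) =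
      -(2 * π * x * I) := by
    field_simp
    linear_combination (2 * I) * hst
  simp only [hMf, hMg, ← ht, hexp, hexp', hz, hz', hw, hw']
  have hden : (1 : ℂ) + t ^ 2 = -((I * t + 1) * (I * t - 1)) := by
    linear_combination (t : ℂ) ^ 2 * Complex.I_sq
  rw [Complex.real_smul]
  push_cast
  rw [hden]
  generalize (∫ ξ in Ioi (0 : ℝ), Complex.exp (-(-(2 * π * x * I)) * ξ) * (f ξ : ℂ)) = A
  generalize (∫ ξ in Ioi (0 : ℝ), Complex.exp (-(2 * π * x * I) * ξ) * (g ξ : ℂ)) = B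
  field_simp
  linear_combination A * B * hsa
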